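/- Let q, ℓ ≥ 2 be integers and m ≥ 1. Suppose F : (0,1)×(0,1] → ℂ satisfies F(α,c) = (1+i)/2 · α^{-1/2} + (1-i)/2 · (1-α)^{-1/2} + c^{-1/2} + O(1) uniformly. Then Σ_{a=1}^{q-1} Σ_{b=1}^{ℓ-1} |F(a/q, b/ℓ)|^{2m} = (ζ(m)/2^{m-1}) q^m (ℓ-1) + ζ(m)(q-1) ℓ^m + O_m(q^{m-1/2} ℓ + q ℓ^{m-1/2}). -/

import Mathlib

open Complex Finset

/-- Partial sums of `n ^ (-1/2)` are at most `2 √N`. -/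
lemma sum_inv_sqrt_le (N : ℕ) : ∑ n ∈ Icc 1 N, (√(n : ℝ))⁻¹ ≤ 2 * √(N : ℝ) := by
  induction N with
  | zero => simp
  | succ N ih =>
    rw [Finset.sum_Icc_succ_top (by omega)]
    have hs := Real.sqrt_nonneg (N : ℝ)
    have ht : 0 < √((N + 1 : ℕ) : ℝ) := Real.sqrt_pos.2 (by positivity)
    have hs2 := Real.sq_sqrt (Nat.cast_nonneg N : (0 : ℝ) ≤ N)
    have ht2 := Real.sq_sqrt (Nat.cast_nonneg (N + 1) : (0 : ℝ) ≤ ((N + 1 : ℕ) : ℝ))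
    set s := √(N : ℝ)
    set t := √((N + 1 : ℕ) : ℝ)
    push_cast at ht2
    have : t⁻¹ ≤ 2 * t - 2 * s := by
      rw [inv_le_iff_one_le_mul₀ ht]
      nlinarith [sq_nonneg (t - s)]
    linarith

/-- Partial sums of `n ^ (-3/2)` are at most `3`. -/
lemma sum_inv_sqrt_cube_le (N : ℕ) : ∑ n ∈ Icc 1 N, (√(n : ℝ))⁻¹ ^ 3 ≤ 3 := by
  have key : ∀ N : ℕ, ∑ n ∈ Icc 1 (N + 1), (√(n : ℝ))⁻¹ ^ 3 ≤
      3 - 2 * (√((N + 1 : ℕ) : ℝ))⁻¹ := by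
    intro N
    induction N with
    | zero => norm_num
    | succ N ih =>
      rw [Finset.sum_Icc_succ_top (by omega)]
      have hs : 0 < √((N + 1 : ℕ) : ℝ) := Real.sqrt_pos.2 (by positivity)
      have ht : 0 < √((N + 1 + 1 : ℕ) : ℝ) := Real.sqrt_pos.2 (by positivity)
      have hs2 := Real.sq_sqrt (Nat.cast_nonneg (N + 1) : (0 : ℝ) ≤ ((N + 1 : ℕ) : ℝ))
      have ht2 := Real.sq_sqrt (Nat.cast_nonneg (N + 1 + 1) : (0 : ℝ) ≤ ((N + 1 + 1 : ℕ) : ℝ))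
      set s := √((N + 1 : ℕ) : ℝ)
      set t := √((N + 1 + 1 : ℕ) : ℝ)
      have hst : t ^ 2 = s ^ 2 + 1 := by rw [hs2, ht2]; push_cast; ring
      have h1 : s ≤ t := by nlinarith
      have : t⁻¹ ^ 3 ≤ 2 * s⁻¹ - 2 * t⁻¹ := by
        have e : 2 * s⁻¹ - 2 * t⁻¹ = 2 * (t - s) / (s * t) := by field_simp
        have e2 : t⁻¹ ^ 3 = 1 / t ^ 3 := by field_simp
        rw [e, e2, div_le_div_iff₀ (by positivity) (by positivity)]
        have h3 : (t - s) * (t + s) = 1 := by linear_combination hst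
        have h4 : s * (t + s) ≤ 2 * t ^ 2 := by nlinarith
        have h5 : s * t = (t - s) * (t * (s * (t + s))) := by linear_combination (-s * t) * h3
        have h6 : (t - s) * (t * (s * (t + s))) ≤ (t - s) * (t * (2 * t ^ 2)) := by
          gcongr
        nlinarith
      linarith
  rcases N with _ | N
  · norm_num
  · have := key N
    have h : 0 ≤ (√((N + 1 : ℕ) : ℝ))⁻¹ := by positivity
    linarith

lemma sum_Icc_reflect (q : ℕ) (f : ℕ → ℝ) :
    ∑ a ∈ Icc 1 (q - 1), f (q - a) = ∑ a ∈ Icc 1 (q - 1), f a := by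
  refine Finset.sum_nbij' (fun a => q - a) (fun a => q - a) ?_ ?_ ?_ ?_ ?_ <;>
    simp only [Finset.mem_Icc, implies_true] <;> intros <;> omega

lemma abs_zeta_sub_sum_le {m : ℕ} (hm : 2 ≤ m) {q : ℕ} (hq : 2 ≤ q) :
    |∑ n ∈ Icc 1 (q - 1), ((n : ℝ) ^ m)⁻¹ - ∑' n : ℕ, ((n : ℝ) ^ m)⁻¹| ≤ 2 * (√(q : ℝ))⁻¹ := by
  have hsum : Summable fun n : ℕ => ((n : ℝ) ^ m)⁻¹ :=
    Real.summable_nat_pow_inv.2 (by omega)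
  have hle : ∑ n ∈ Icc 1 (q - 1), ((n : ℝ) ^ m)⁻¹ ≤ ∑' n : ℕ, ((n : ℝ) ^ m)⁻¹ :=
    hsum.sum_le_tsum _ fun i _ => by positivity
  have hge : ∑' n : ℕ, ((n : ℝ) ^ m)⁻¹ ≤ ∑ n ∈ Icc 1 (q - 1), ((n : ℝ) ^ m)⁻¹ + 2 / q := by
    refine hsum.tsum_le_of_sum_range_le fun N => ?_
    calc ∑ n ∈ range N, ((n : ℝ) ^ m)⁻¹
        ≤ ∑ n ∈ Icc 1 (q - 1) ∪ Ioo (q - 1) N, ((n : ℝ) ^ m)⁻¹ := by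
          rw [← Finset.sum_filter_ne_zero (s := range N)]
          refine Finset.sum_le_sum_of_subset_of_nonneg ?_ fun i _ _ => by positivity
          intro n
          simp only [mem_filter, mem_range, mem_union, mem_Icc, mem_Ioo]
          rintro ⟨h1, h2⟩
          have : n ≠ 0 := by
            rintro rfl
            exact h2 (by simp; omega)
          omega
      _ = ∑ n ∈ Icc 1 (q - 1), ((n : ℝ) ^ m)⁻¹ + ∑ n ∈ Ioo (q - 1) N, ((n : ℝ) ^ m)⁻¹ := by
          refine Finset.sum_union ?_
          rw [Finset.disjoint_left]
          intro n
          simp only [mem_Icc, mem_Ioo]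
          omega
      _ ≤ ∑ n ∈ Icc 1 (q - 1), ((n : ℝ) ^ m)⁻¹ + ∑ n ∈ Ioo (q - 1) N, ((n : ℝ) ^ 2)⁻¹ := by
          gcongr with n hn
          · have : 0 < n := by simp only [mem_Ioo] at hn; omega
            positivity
          · have : 1 ≤ n := by simp only [mem_Ioo] at hn; omega
            exact_mod_cast this
      _ ≤ _ := by
          have := sum_Ioo_inv_sq_le (α := ℝ) (q - 1) N
          have e : (((q - 1 : ℕ) : ℝ) + 1) = q := by
            rw [Nat.cast_sub (by omega)]; simp
          rw [e] at this
          linarith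
  have h2 : 2 / (q : ℝ) ≤ 2 * (√(q : ℝ))⁻¹ := by
    rw [div_eq_mul_inv]
    have : √(q : ℝ) ≤ q := by
      rw [Real.sqrt_le_left (by positivity)]
      have : (1 : ℝ) ≤ q := by exact_mod_cast (by omega : 1 ≤ q)
      nlinarith
    have hq0 : 0 < √(q : ℝ) := Real.sqrt_pos.2 (by exact_mod_cast (by omega : 0 < q))
    gcongr
  rw [abs_le]
  constructor <;> [linarith; skip]
  have : 0 ≤ 2 * (√(q : ℝ))⁻¹ := by positivity
  linarith

lemma add_pow_sub_pow_sub_pow_le {s t : ℝ} (hs : 0 ≤ s) (hs1 : s ≤ 1) (ht : 0 ≤ t) (ht1 : t ≤ 1)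
    {m : ℕ} (hm : 1 ≤ m) : |(s + t) ^ m - s ^ m - t ^ m| ≤ 2 ^ m * (s * t) := by
  have hst : 0 ≤ s * t := by positivity
  suffices h : 0 ≤ (s + t) ^ m - s ^ m - t ^ m ∧
      (s + t) ^ m - s ^ m - t ^ m ≤ (2 ^ m - 2) * (s * t) by
    rw [abs_of_nonneg h.1]
    linarith [h.2]
  induction m, hm using Nat.le_induction with
  | base => simp
  | succ m hm ih =>
    obtain ⟨h0, h1⟩ := ih
    set D := (s + t) ^ m - s ^ m - t ^ m with hD
    have e : (s + t) ^ (m + 1) - s ^ (m + 1) - t ^ (m + 1) =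
        (s + t) * D + s ^ m * t + s * t ^ m := by rw [hD]; ring
    have hsm : s ^ m ≤ s := pow_le_of_le_one hs hs1 (by omega)
    have htm : t ^ m ≤ t := pow_le_of_le_one ht ht1 (by omega)
    rw [e]
    refine ⟨by positivity, ?_⟩
    have a1 : (s + t) * D ≤ 2 * ((2 ^ m - 2) * (s * t)) := by
      calc (s + t) * D ≤ 2 * D := by gcongr; linarith
        _ ≤ _ := by gcongr
    have a2 : s ^ m * t ≤ s * t := by gcongr
    have a3 : s * t ^ m ≤ s * t := by gcongr
    rw [pow_succ]
    linarith

/-- A number at distance at most `y + C` from `x`, where `1 ≤ y ≤ x`, has `n`-th power close to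
`x ^ n + y ^ n`. -/
lemma abs_pow_sub_pow_sub_pow_le_of_le {x y C T : ℝ} (hC : 0 < C) (hy : 1 ≤ y) (hxy : y ≤ x)
    (hT : 0 ≤ T) (h : |T - x| ≤ y + C) (n : ℕ) :
    |T ^ (n + 1) - x ^ (n + 1) - y ^ (n + 1)| ≤
      ((n + 1) * (1 + C) * (2 + C) ^ n + 1) * (x ^ n * y) := by
  have hx : 0 ≤ x := by linarith
  have hy0 : 0 ≤ y := by linarith
  have h1 : |T - x| ≤ (1 + C) * y := by nlinarith
  have hTle : T ≤ (2 + C) * x := by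
    have := (abs_le.1 h1).2
    nlinarith
  have hmax : max |T| |x| ≤ (2 + C) * x := by
    rw [abs_of_nonneg hT, abs_of_nonneg hx]
    exact max_le hTle (by nlinarith)
  have h2 := abs_pow_sub_pow_le T x (n + 1)
  have h3 : |T ^ (n + 1) - x ^ (n + 1)| ≤ (1 + C) * y * (n + 1) * ((2 + C) * x) ^ n := by
    refine h2.trans ?_
    simp only [Nat.add_sub_cancel]
    push_cast
    gcongr
  have h4 : y ^ (n + 1) ≤ x ^ n * y := by
    rw [pow_succ]
    gcongr
  have h5 : 0 ≤ y ^ (n + 1) := by positivity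
  rw [mul_pow] at h3
  calc _ ≤ |T ^ (n + 1) - x ^ (n + 1)| + |y ^ (n + 1)| := abs_sub _ _
    _ ≤ (1 + C) * y * (n + 1) * ((2 + C) ^ n * x ^ n) + x ^ n * y := by
        rw [abs_of_nonneg h5]
        gcongr
    _ = _ := by ring

lemma abs_norm_pow_sub_pow_sub_pow_le {C : ℝ} (hC : 0 < C) {z u v : ℂ} (hu : 1 ≤ ‖u‖)
    (hv : 1 ≤ ‖v‖) (h : ‖z - (u + v)‖ ≤ C) (n : ℕ) :
    |‖z‖ ^ (n + 1) - ‖u‖ ^ (n + 1) - ‖v‖ ^ (n + 1)| ≤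
      ((n + 1) * (1 + C) * (2 + C) ^ n + 1) * (‖u‖ ^ n * ‖v‖ + ‖u‖ * ‖v‖ ^ n) := by
  have hK : 0 ≤ (n + 1) * (1 + C) * (2 + C) ^ n + 1 := by positivity
  have close : ∀ u v : ℂ, ‖z - (u + v)‖ ≤ C → |‖z‖ - ‖u‖| ≤ ‖v‖ + C := by
    intro u v h
    calc |‖z‖ - ‖u‖| ≤ ‖z - u‖ := abs_norm_sub_norm_le _ _
      _ = ‖v + (z - (u + v))‖ := by congr 1; ring
      _ ≤ ‖v‖ + ‖z - (u + v)‖ := norm_add_le _ _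
      _ ≤ _ := by gcongr
  rcases le_total ‖v‖ ‖u‖ with huv | huv
  · refine (abs_pow_sub_pow_sub_pow_le_of_le hC hv huv (norm_nonneg z) (close u v h) n).trans ?_
    gcongr
    exact le_add_of_nonneg_right (by positivity)
  · rw [sub_right_comm]
    refine (abs_pow_sub_pow_sub_pow_le_of_le hC hu huv (norm_nonneg z)
      (close v u (by rwa [add_comm v u])) n).trans ?_
    gcongr
    rw [mul_comm]
    exact le_add_of_nonneg_left (by positivity)

lemma ofReal_cpow_neg_half {x : ℝ} (hx : 0 ≤ x) :
    (x : ℂ) ^ (-(1 / 2) : ℂ) = (((√x)⁻¹ : ℝ) : ℂ) := by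
  rw [Real.sqrt_eq_rpow, ← Real.rpow_neg hx, Complex.ofReal_cpow hx]
  norm_num

lemma sq_norm_singular_part {α : ℝ} (h0 : 0 < α) (h1 : α < 1) :
    ‖(1 + I) / 2 * (α : ℂ) ^ (-(1 / 2) : ℂ) +
      (1 - I) / 2 * ((1 - α : ℝ) : ℂ) ^ (-(1 / 2) : ℂ)‖ ^ 2 = (α⁻¹ + (1 - α)⁻¹) / 2 := by
  have h1' : 0 ≤ 1 - α := by linarith
  rw [ofReal_cpow_neg_half h0.le, ofReal_cpow_neg_half h1']
  have e1 : α⁻¹ = (√α)⁻¹ ^ 2 := by rw [inv_pow, Real.sq_sqrt h0.le]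
  have e2 : (1 - α)⁻¹ = (√(1 - α))⁻¹ ^ 2 := by rw [inv_pow, Real.sq_sqrt h1']
  rw [e1, e2]
  generalize (√α)⁻¹ = p
  generalize (√(1 - α))⁻¹ = r
  have e : (1 + I) / 2 * (p : ℂ) + (1 - I) / 2 * (r : ℂ) =
      (((p + r) / 2 : ℝ) : ℂ) + (((p - r) / 2 : ℝ) : ℂ) * I := by
    push_cast
    ring
  rw [e, ← Complex.normSq_eq_norm_sq, Complex.normSq_add_mul_I]
  ring

/-- The singular part of `F` in the first variable. -/
noncomputable def singularPart (α : ℝ) : ℂ :=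
  (1 + I) / 2 * (α : ℂ) ^ (-(1 / 2) : ℂ) + (1 - I) / 2 * ((1 - α : ℝ) : ℂ) ^ (-(1 / 2) : ℂ)

lemma sq_norm_singularPart_div {q a : ℕ} (ha : a ∈ Icc 1 (q - 1)) :
    ‖singularPart ((a : ℝ) / q)‖ ^ 2 =
      q / 2 * ((a : ℝ)⁻¹ + ((q - a : ℕ) : ℝ)⁻¹) := by
  rw [mem_Icc] at ha
  have hq : (0 : ℝ) < q := by exact_mod_cast (by omega : 0 < q)
  have ha0 : (0 : ℝ) < a := by exact_mod_cast (by omega : 0 < a)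
  have haq : (a : ℝ) < q := by exact_mod_cast (by omega : a < q)
  rw [singularPart, sq_norm_singular_part (by positivity) ((div_lt_one hq).2 haq),
    Nat.cast_sub (by omega)]
  have : (q : ℝ) - a ≠ 0 := by linarith
  have e : 1 - (a : ℝ) / q = (q - a) / q := by field_simp
  rw [e, inv_div, inv_div]
  field_simp

lemma one_le_norm_singularPart {α : ℝ} (h0 : 0 < α) (h1 : α < 1) : 1 ≤ ‖singularPart α‖ := by
  have h := sq_norm_singular_part h0 h1
  have a1 : 1 ≤ α⁻¹ := (one_le_inv₀ h0).2 h1.le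
  have a2 : 1 ≤ (1 - α)⁻¹ := (one_le_inv₀ (by linarith)).2 (by linarith)
  rw [← one_le_sq_iff₀ (norm_nonneg _), singularPart, h]
  linarith

lemma norm_singularPart_div_le {q a : ℕ} (ha : a ∈ Icc 1 (q - 1)) :
    ‖singularPart ((a : ℝ) / q)‖ ≤ √q * ((√(a : ℝ))⁻¹ + (√((q - a : ℕ) : ℝ))⁻¹) := by
  refine le_of_sq_le_sq ?_ (by positivity)
  rw [sq_norm_singularPart_div ha, mul_pow, Real.sq_sqrt (by positivity), div_mul_eq_mul_div,
    mul_div_assoc]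
  gcongr
  have e1 : (a : ℝ)⁻¹ = (√(a : ℝ))⁻¹ ^ 2 := by rw [inv_pow, Real.sq_sqrt (by positivity)]
  have e2 : ((q - a : ℕ) : ℝ)⁻¹ = (√((q - a : ℕ) : ℝ))⁻¹ ^ 2 := by
    rw [inv_pow, Real.sq_sqrt (by positivity)]
  rw [e1, e2]
  have h1 : 0 ≤ (√(a : ℝ))⁻¹ := by positivity
  have h2 : 0 ≤ (√((q - a : ℕ) : ℝ))⁻¹ := by positivity
  nlinarith [mul_nonneg h1 h2]

lemma inv_sqrt_le_one {n : ℕ} (hn : 1 ≤ n) : (√(n : ℝ))⁻¹ ≤ 1 :=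
  inv_le_one_of_one_le₀ (Real.one_le_sqrt.2 (by exact_mod_cast hn))

lemma sum_inv_sqrt_pow_le {k : ℕ} (hk : 3 ≤ k) (N : ℕ) :
    ∑ n ∈ Icc 1 N, (√(n : ℝ))⁻¹ ^ k ≤ 3 :=
  (Finset.sum_le_sum fun _ hn => pow_le_pow_of_le_one (by positivity)
    (inv_sqrt_le_one (mem_Icc.1 hn).1) hk).trans (sum_inv_sqrt_cube_le N)

lemma sum_norm_singularPart_le (q : ℕ) :
    ∑ a ∈ Icc 1 (q - 1), ‖singularPart ((a : ℝ) / q)‖ ≤ 4 * q := by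
  have h1 : ∑ n ∈ Icc 1 (q - 1), (√(n : ℝ))⁻¹ ≤ 2 * √(q : ℝ) :=
    (sum_inv_sqrt_le (q - 1)).trans (by gcongr; omega)
  calc _ ≤ ∑ a ∈ Icc 1 (q - 1), √q * ((√(a : ℝ))⁻¹ + (√((q - a : ℕ) : ℝ))⁻¹) :=
        Finset.sum_le_sum fun a ha => norm_singularPart_div_le ha
    _ = √q * (2 * ∑ n ∈ Icc 1 (q - 1), (√(n : ℝ))⁻¹) := by
        rw [← Finset.mul_sum, Finset.sum_add_distrib,
          sum_Icc_reflect q fun n => (√(n : ℝ))⁻¹]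
        ring
    _ ≤ √q * (2 * (2 * √q)) := by gcongr
    _ = 4 * (√q * √q) := by ring
    _ = 4 * q := by rw [Real.mul_self_sqrt (by positivity)]

lemma sum_norm_singularPart_pow_le {k : ℕ} (hk : 3 ≤ k) (q : ℕ) :
    ∑ a ∈ Icc 1 (q - 1), ‖singularPart ((a : ℝ) / q)‖ ^ k ≤ 2 ^ (k - 1) * 6 * √q ^ k := by
  have h1 := sum_inv_sqrt_pow_le hk (q - 1)
  calc _ ≤ ∑ a ∈ Icc 1 (q - 1), √q ^ k * (2 ^ (k - 1) *
        ((√(a : ℝ))⁻¹ ^ k + (√((q - a : ℕ) : ℝ))⁻¹ ^ k)) := by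
        refine Finset.sum_le_sum fun a ha => ?_
        refine (pow_le_pow_left₀ (norm_nonneg _) (norm_singularPart_div_le ha) k).trans ?_
        rw [mul_pow]
        gcongr
        exact add_pow_le (by positivity) (by positivity) k
    _ = √q ^ k * (2 ^ (k - 1) * (2 * ∑ n ∈ Icc 1 (q - 1), (√(n : ℝ))⁻¹ ^ k)) := by
        rw [← Finset.mul_sum, ← Finset.mul_sum, Finset.sum_add_distrib,
          sum_Icc_reflect q fun n => (√(n : ℝ))⁻¹ ^ k]
        ring
    _ ≤ √q ^ k * (2 ^ (k - 1) * (2 * 3)) := by gcongr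
    _ = _ := by ring

lemma natCast_pow_mul_inv_sqrt {q m : ℕ} (hq : 0 < q) (hm : 1 ≤ m) :
    (q : ℝ) ^ m * (√(q : ℝ))⁻¹ = √(q : ℝ) ^ (2 * m - 1) := by
  have hq0 : 0 < √(q : ℝ) := Real.sqrt_pos.2 (by exact_mod_cast hq)
  rw [← div_eq_mul_inv, div_eq_iff hq0.ne', ← pow_succ, Nat.sub_add_cancel (by omega), pow_mul,
    Real.sq_sqrt (by positivity)]

lemma sum_inv_mul_inv_reflect_le {q : ℕ} (hq : 0 < q) :
    ∑ a ∈ Icc 1 (q - 1), (a : ℝ)⁻¹ * ((q - a : ℕ) : ℝ)⁻¹ ≤ 4 * (√(q : ℝ))⁻¹ := by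
  have hq0 : (0 : ℝ) < q := by exact_mod_cast hq
  have hs : ∑ n ∈ Icc 1 (q - 1), (n : ℝ)⁻¹ ≤ 2 * √(q : ℝ) := by
    refine le_trans ?_ ((sum_inv_sqrt_le (q - 1)).trans (by gcongr; omega))
    refine Finset.sum_le_sum fun n hn => ?_
    have h := inv_sqrt_le_one (mem_Icc.1 hn).1
    have e : (n : ℝ)⁻¹ = (√(n : ℝ))⁻¹ ^ 2 := by rw [inv_pow, Real.sq_sqrt (by positivity)]
    rw [e]
    exact pow_le_of_le_one (by positivity) h two_ne_zero
  calc _ = ∑ a ∈ Icc 1 (q - 1), (q : ℝ)⁻¹ * ((a : ℝ)⁻¹ + ((q - a : ℕ) : ℝ)⁻¹) := by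
        refine Finset.sum_congr rfl fun a ha => ?_
        rw [mem_Icc] at ha
        have h1 : (0 : ℝ) < a := by exact_mod_cast (by omega : 0 < a)
        have h2 : (a : ℝ) < q := by exact_mod_cast (by omega : a < q)
        have h3 : (q : ℝ) - a ≠ 0 := by linarith
        rw [Nat.cast_sub (by omega)]
        field_simp
        ring
    _ = (q : ℝ)⁻¹ * (2 * ∑ n ∈ Icc 1 (q - 1), (n : ℝ)⁻¹) := by
        rw [← Finset.mul_sum, Finset.sum_add_distrib, sum_Icc_reflect q fun n => (n : ℝ)⁻¹]
        ring
    _ ≤ (q : ℝ)⁻¹ * (2 * (2 * √(q : ℝ))) := by gcongr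
    _ = 4 * (√(q : ℝ) / q) := by ring
    _ = _ := by rw [Real.sqrt_div_self', one_div]

lemma abs_sum_norm_singularPart_pow_sub_le {m : ℕ} (hm : 2 ≤ m) {q : ℕ} (hq : 2 ≤ q) :
    |∑ a ∈ Icc 1 (q - 1), ‖singularPart ((a : ℝ) / q)‖ ^ (2 * m) -
      (∑' n : ℕ, ((n : ℝ) ^ m)⁻¹) / 2 ^ (m - 1) * q ^ m| ≤
      (2 ^ m * 4 + 4) * √q ^ (2 * m - 1) := by
  set Z := ∑' n : ℕ, ((n : ℝ) ^ m)⁻¹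
  have hZ := abs_zeta_sub_sum_le hm hq
  set P := ∑ n ∈ Icc 1 (q - 1), ((n : ℝ) ^ m)⁻¹ with hP
  have hS : |∑ a ∈ Icc 1 (q - 1), ((a : ℝ)⁻¹ + ((q - a : ℕ) : ℝ)⁻¹) ^ m - 2 * P| ≤
      2 ^ m * (4 * (√(q : ℝ))⁻¹) := by
    have e : 2 * P = ∑ a ∈ Icc 1 (q - 1), ((a : ℝ)⁻¹ ^ m + ((q - a : ℕ) : ℝ)⁻¹ ^ m) := by
      rw [Finset.sum_add_distrib, sum_Icc_reflect q fun n => (n : ℝ)⁻¹ ^ m, hP]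
      simp only [inv_pow]
      ring
    rw [e, ← Finset.sum_sub_distrib]
    refine (Finset.abs_sum_le_sum_abs _ _).trans ?_
    refine le_trans (Finset.sum_le_sum fun a ha => ?_)
      ((Finset.mul_sum _ _ _).symm.le.trans
        (mul_le_mul_of_nonneg_left (sum_inv_mul_inv_reflect_le (q := q) (by omega))
          (by positivity)))
    rw [mem_Icc] at ha
    rw [← sub_sub]
    exact add_pow_sub_pow_sub_pow_le (by positivity)
      (inv_le_one_of_one_le₀ (by exact_mod_cast ha.1)) (by positivity)
      (inv_le_one_of_one_le₀ (by exact_mod_cast (by omega : 1 ≤ q - a))) (by omega)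
  have hX : ∑ a ∈ Icc 1 (q - 1), ‖singularPart ((a : ℝ) / q)‖ ^ (2 * m) =
      (q : ℝ) ^ m / 2 ^ m * ∑ a ∈ Icc 1 (q - 1), ((a : ℝ)⁻¹ + ((q - a : ℕ) : ℝ)⁻¹) ^ m := by
    rw [Finset.mul_sum]
    refine Finset.sum_congr rfl fun a ha => ?_
    rw [pow_mul, sq_norm_singularPart_div ha, mul_pow, div_pow]
  set S := ∑ a ∈ Icc 1 (q - 1), ((a : ℝ)⁻¹ + ((q - a : ℕ) : ℝ)⁻¹) ^ m
  have h2 : (2 : ℝ) ^ m = 2 * 2 ^ (m - 1) := by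
    rw [← pow_succ', Nat.sub_add_cancel (by omega)]
  have e : (q : ℝ) ^ m / 2 ^ m * S - Z / 2 ^ (m - 1) * q ^ m =
      (q : ℝ) ^ m / 2 ^ m * ((S - 2 * P) + 2 * (P - Z)) := by
    rw [h2]
    field_simp
    ring
  rw [hX, e, abs_mul, abs_of_nonneg (by positivity : (0 : ℝ) ≤ (q : ℝ) ^ m / 2 ^ m)]
  calc _ ≤ (q : ℝ) ^ m * (2 ^ m * (4 * (√(q : ℝ))⁻¹) + 2 * (2 * (√(q : ℝ))⁻¹)) := by
        gcongr
        · exact div_le_self (by positivity) (one_le_pow₀ one_le_two)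
        · refine (abs_add_le _ _).trans ?_
          rw [abs_mul, abs_two]
          gcongr
    _ = (2 ^ m * 4 + 4) * ((q : ℝ) ^ m * (√(q : ℝ))⁻¹) := by ring
    _ = _ := by rw [natCast_pow_mul_inv_sqrt (by omega) (by omega)]

lemma norm_cpow_neg_half_div (b ℓ : ℕ) :
    ‖(((b : ℝ) / ℓ : ℝ) : ℂ) ^ (-(1 / 2) : ℂ)‖ = √ℓ * (√(b : ℝ))⁻¹ := by
  rw [ofReal_cpow_neg_half (by positivity), Complex.norm_real, Real.norm_of_nonneg (by positivity),
    Real.sqrt_div (by positivity), inv_div, div_eq_mul_inv]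

lemma natCast_rpow_sub_half (n : ℕ) {m : ℕ} (hm : 1 ≤ m) :
    (n : ℝ) ^ ((m : ℝ) - 1 / 2) = √(n : ℝ) ^ (2 * m - 1) := by
  rw [Real.sqrt_eq_rpow, ← Real.rpow_natCast, ← Real.rpow_mul (by positivity),
    Nat.cast_sub (by omega)]
  congr 1
  push_cast
  ring

/-- Double moment asymptotics: if `F(α,c) = (1+i)/2·α^{-1/2} + (1-i)/2·(1-α)^{-1/2}
+ c^{-1/2} + O(1)` uniformly, then for `m ≥ 2`,
`Σ_{a=1}^{q-1} Σ_{b=1}^{ℓ-1} |F(a/q,b/ℓ)|^{2m}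
= (ζ(m)/2^{m-1}) q^m (ℓ-1) + ζ(m)(q-1)ℓ^m + O_m(q^{m-1/2}ℓ + q ℓ^{m-1/2})`. -/
theorem double_moment_asymptotic (m : ℕ) (hm : 2 ≤ m) (C₀ : ℝ) (hC₀ : 0 < C₀) :
    ∃ A : ℝ, 0 < A ∧ ∀ q ℓ : ℕ, 2 ≤ q → 2 ≤ ℓ → ∀ F : ℝ → ℝ → ℂ,
      (∀ α ∈ Set.Ioo (0 : ℝ) 1, ∀ c ∈ Set.Ioc (0 : ℝ) 1,
        ‖F α c - ((1 + I) / 2 * (α : ℂ) ^ (-(1 / 2) : ℂ) +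
            (1 - I) / 2 * ((1 - α : ℝ) : ℂ) ^ (-(1 / 2) : ℂ) +
            (c : ℂ) ^ (-(1 / 2) : ℂ))‖ ≤ C₀) →
      ‖((∑ a ∈ Finset.Icc 1 (q - 1), ∑ b ∈ Finset.Icc 1 (ℓ - 1),
              ‖F ((a : ℝ) / q) ((b : ℝ) / ℓ)‖ ^ (2 * m) : ℝ) : ℂ) -
          (riemannZeta m / 2 ^ (m - 1) * (q : ℂ) ^ m * ((ℓ : ℂ) - 1) +
            riemannZeta m * ((q : ℂ) - 1) * (ℓ : ℂ) ^ m)‖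
        ≤ A * ((q : ℝ) ^ ((m : ℝ) - 1 / 2) * ℓ + q * (ℓ : ℝ) ^ ((m : ℝ) - 1 / 2)) := by
  obtain ⟨k, hk⟩ : ∃ k, k + 1 = 2 * m := ⟨2 * m - 1, by omega⟩
  have hk3 : 3 ≤ k := by omega
  have hk' : 2 * m - 1 = k := by omega
  set K : ℝ := (k + 1) * (1 + C₀) * (2 + C₀) ^ k + 1
  have hK0 : 0 < K := by positivity
  refine ⟨K * (2 ^ (k - 1) * 12 + 12) + (2 ^ m * 4 + 4) + 2, by positivity, ?_⟩
  intro q ℓ hq hℓ F hF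
  have hq0 : (0 : ℝ) < q := by exact_mod_cast (by omega : 0 < q)
  have hℓ0 : (0 : ℝ) < ℓ := by exact_mod_cast (by omega : 0 < ℓ)
  rw [natCast_rpow_sub_half q (by omega), natCast_rpow_sub_half ℓ (by omega)]
  have hZ : riemannZeta m = ((∑' n : ℕ, ((n : ℝ) ^ m)⁻¹ : ℝ) : ℂ) := by
    rw [zeta_nat_eq_tsum_of_gt_one (by omega)]
    push_cast
    simp only [one_div]
  set x : ℕ → ℝ := fun a => ‖singularPart ((a : ℝ) / q)‖
  set y : ℕ → ℝ := fun b => √ℓ * (√(b : ℝ))⁻¹ with hy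
  have hX := abs_sum_norm_singularPart_pow_sub_le hm hq
  have hxk : ∑ a ∈ Icc 1 (q - 1), x a ^ k ≤ 2 ^ (k - 1) * 6 * √q ^ k :=
    sum_norm_singularPart_pow_le hk3 q
  have hx1 : ∑ a ∈ Icc 1 (q - 1), x a ≤ 4 * q := sum_norm_singularPart_le q
  have hyk : ∑ b ∈ Icc 1 (ℓ - 1), y b ^ k ≤ 3 * √ℓ ^ k := by
    simp only [hy, mul_pow]
    rw [← Finset.mul_sum, mul_comm]
    gcongr
    exact sum_inv_sqrt_pow_le hk3 _
  have hy1 : ∑ b ∈ Icc 1 (ℓ - 1), y b ≤ 2 * ℓ := by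
    rw [← Finset.mul_sum]
    calc _ ≤ √ℓ * (2 * √(ℓ : ℝ)) := by
          gcongr
          exact (sum_inv_sqrt_le (ℓ - 1)).trans (by gcongr; omega)
      _ = 2 * (√ℓ * √ℓ) := by ring
      _ = _ := by rw [Real.mul_self_sqrt hℓ0.le]
  have hY : |∑ b ∈ Icc 1 (ℓ - 1), y b ^ (2 * m) - (∑' n : ℕ, ((n : ℝ) ^ m)⁻¹) * ℓ ^ m| ≤
      2 * √ℓ ^ k := by
    have e : ∑ b ∈ Icc 1 (ℓ - 1), y b ^ (2 * m) =
        (ℓ : ℝ) ^ m * ∑ b ∈ Icc 1 (ℓ - 1), ((b : ℝ) ^ m)⁻¹ := by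
      rw [Finset.mul_sum]
      refine Finset.sum_congr rfl fun b _ => ?_
      simp only [hy]
      rw [pow_mul, mul_pow, inv_pow, Real.sq_sqrt hℓ0.le, Real.sq_sqrt (by positivity), mul_pow,
        inv_pow]
    rw [e, mul_comm _ ((ℓ : ℝ) ^ m), ← mul_sub, abs_mul, abs_of_nonneg (by positivity), ← hk',
      ← natCast_pow_mul_inv_sqrt (by omega) (by omega), mul_left_comm]
    gcongr
    exact abs_zeta_sub_sum_le hm hℓ
  rw [hZ]
  set Z : ℝ := ∑' n : ℕ, ((n : ℝ) ^ m)⁻¹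
  rw [hk'] at hX ⊢
  have hpt : ∀ a ∈ Icc 1 (q - 1), ∀ b ∈ Icc 1 (ℓ - 1),
      |‖F ((a : ℝ) / q) ((b : ℝ) / ℓ)‖ ^ (2 * m) - x a ^ (2 * m) - y b ^ (2 * m)| ≤
        K * (x a ^ k * y b + x a * y b ^ k) := by
    intro a ha b hb
    rw [mem_Icc] at ha hb
    have ha0 : (0 : ℝ) < a := by exact_mod_cast (by omega : 0 < a)
    have hb0 : (0 : ℝ) < b := by exact_mod_cast (by omega : 0 < b)
    have haq : (a : ℝ) / q < 1 := (div_lt_one hq0).2 (by exact_mod_cast (by omega : a < q))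
    have hbℓ : (b : ℝ) / ℓ ≤ 1 := (div_le_one hℓ0).2 (by exact_mod_cast (by omega : b ≤ ℓ))
    have h := hF ((a : ℝ) / q) ⟨by positivity, haq⟩ ((b : ℝ) / ℓ) ⟨by positivity, hbℓ⟩
    have hv : 1 ≤ y b := by
      simp only [hy]
      rw [← div_eq_mul_inv, one_le_div (Real.sqrt_pos.2 hb0)]
      exact Real.sqrt_le_sqrt (by exact_mod_cast (by omega : b ≤ ℓ))
    have hyb : ‖(((b : ℝ) / ℓ : ℝ) : ℂ) ^ (-(1 / 2) : ℂ)‖ = y b := norm_cpow_neg_half_div b ℓ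
    have := abs_norm_pow_sub_pow_sub_pow_le hC₀
      (one_le_norm_singularPart (div_pos ha0 hq0) haq) (hyb ▸ hv) h k
    rw [hyb, hk] at this
    exact this
  have hsum : |∑ a ∈ Icc 1 (q - 1), ∑ b ∈ Icc 1 (ℓ - 1),
        ‖F ((a : ℝ) / q) ((b : ℝ) / ℓ)‖ ^ (2 * m) -
      ((ℓ - 1) * ∑ a ∈ Icc 1 (q - 1), x a ^ (2 * m) +
        (q - 1) * ∑ b ∈ Icc 1 (ℓ - 1), y b ^ (2 * m))| ≤
      K * ((∑ a ∈ Icc 1 (q - 1), x a ^ k) * (∑ b ∈ Icc 1 (ℓ - 1), y b) +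
        (∑ a ∈ Icc 1 (q - 1), x a) * ∑ b ∈ Icc 1 (ℓ - 1), y b ^ k) := by
    have e : (ℓ - 1) * ∑ a ∈ Icc 1 (q - 1), x a ^ (2 * m) +
        (q - 1) * ∑ b ∈ Icc 1 (ℓ - 1), y b ^ (2 * m) =
        ∑ a ∈ Icc 1 (q - 1), ∑ b ∈ Icc 1 (ℓ - 1), (x a ^ (2 * m) + y b ^ (2 * m)) := by
      simp only [Finset.sum_add_distrib, Finset.sum_const, Nat.card_Icc, nsmul_eq_mul,
        Nat.add_sub_cancel, ← Finset.mul_sum]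
      rw [Nat.cast_sub (by omega), Nat.cast_sub (by omega), Nat.cast_one]
    rw [e, Finset.sum_mul_sum, Finset.sum_mul_sum, ← Finset.sum_add_distrib, Finset.mul_sum,
      ← Finset.sum_sub_distrib]
    refine (Finset.abs_sum_le_sum_abs _ _).trans (Finset.sum_le_sum fun a ha => ?_)
    rw [← Finset.sum_sub_distrib, ← Finset.sum_add_distrib, Finset.mul_sum]
    refine (Finset.abs_sum_le_sum_abs _ _).trans (Finset.sum_le_sum fun b hb => ?_)
    rw [← sub_sub]
    exact hpt a ha b hb
  set T := ∑ a ∈ Icc 1 (q - 1), ∑ b ∈ Icc 1 (ℓ - 1), ‖F ((a : ℝ) / q) ((b : ℝ) / ℓ)‖ ^ (2 * m)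
  have hcast : (T : ℂ) - ((Z : ℂ) / 2 ^ (m - 1) * (q : ℂ) ^ m * ((ℓ : ℂ) - 1) +
      Z * ((q : ℂ) - 1) * (ℓ : ℂ) ^ m) =
      ((T - (Z / 2 ^ (m - 1) * q ^ m * (ℓ - 1) + Z * (q - 1) * ℓ ^ m) : ℝ) : ℂ) := by
    push_cast
    ring
  rw [hcast, Complex.norm_real, Real.norm_eq_abs]
  set X := ∑ a ∈ Icc 1 (q - 1), x a ^ (2 * m)
  set Y := ∑ b ∈ Icc 1 (ℓ - 1), y b ^ (2 * m)
  have hq1 : (0 : ℝ) ≤ q - 1 := sub_nonneg.2 (by exact_mod_cast (by omega : 1 ≤ q))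
  have hℓ1 : (0 : ℝ) ≤ ℓ - 1 := sub_nonneg.2 (by exact_mod_cast (by omega : 1 ≤ ℓ))
  have hsplit : T - (Z / 2 ^ (m - 1) * q ^ m * (ℓ - 1) + Z * (q - 1) * ℓ ^ m) =
      (T - ((ℓ - 1) * X + (q - 1) * Y)) + ((ℓ - 1) * (X - Z / 2 ^ (m - 1) * q ^ m) +
        (q - 1) * (Y - Z * ℓ ^ m)) := by
    ring
  have hQ : 0 ≤ √(q : ℝ) ^ k * ℓ := by positivity
  have hL : 0 ≤ q * √(ℓ : ℝ) ^ k := by positivity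
  have b1 : |T - ((ℓ - 1) * X + (q - 1) * Y)| ≤
      K * (2 ^ (k - 1) * 12 + 12) * (√(q : ℝ) ^ k * ℓ + q * √(ℓ : ℝ) ^ k) := by
    calc _ ≤ _ := hsum
      _ ≤ K * ((2 ^ (k - 1) * 6 * √q ^ k) * (2 * ℓ) + (4 * q) * (3 * √ℓ ^ k)) := by
        gcongr
      _ = K * (2 ^ (k - 1) * 12 * (√(q : ℝ) ^ k * ℓ) + 12 * (q * √(ℓ : ℝ) ^ k)) := by ring
      _ ≤ K * ((2 ^ (k - 1) * 12 + 12) * (√(q : ℝ) ^ k * ℓ) +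
          (2 ^ (k - 1) * 12 + 12) * (q * √(ℓ : ℝ) ^ k)) := by
        gcongr
        · exact le_add_of_nonneg_right (by norm_num)
        · exact le_add_of_nonneg_left (by positivity)
      _ = _ := by ring
  have b2 : |(ℓ - 1) * (X - Z / 2 ^ (m - 1) * q ^ m)| ≤
      (2 ^ m * 4 + 4) * (√(q : ℝ) ^ k * ℓ) := by
    rw [abs_mul, abs_of_nonneg hℓ1]
    calc _ ≤ (ℓ : ℝ) * ((2 ^ m * 4 + 4) * √q ^ k) := by
          gcongr
          linarith
      _ = _ := by ring
  have b3 : |(q - 1) * (Y - Z * ℓ ^ m)| ≤ 2 * (q * √(ℓ : ℝ) ^ k) := by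
    rw [abs_mul, abs_of_nonneg hq1]
    calc _ ≤ (q : ℝ) * (2 * √ℓ ^ k) := by
          gcongr
          linarith
      _ = _ := by ring
  rw [hsplit]
  refine (abs_add_le _ _).trans ((add_le_add b1 ((abs_add_le _ _).trans
    (add_le_add b2 b3))).trans ?_)
  have c1 : 0 ≤ (2 ^ m * 4 + 4) * (q * √(ℓ : ℝ) ^ k) := by positivity
  linarith
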